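/- arXiv:math/0309364 — 7 statements merged into one kernel-verified Lean document; each statement's English description precedes it below -/
import Mathlib

section
/- Let (ρ,K) be an AY pair for the Coxeter system (W,S) and let v,w ∈ K. If there exists a ρ-feasible geodesic from v to w, then every geodesic in X(W,S) from v to w is ρ-feasible (in particular, all vertices of every such geodesic lie in K). -/
open CoxeterSystem

variable {B W : Type*} [Group W] {M : CoxeterMatrix B}

/-- The basis vector `C_w` of the vector space `V_K` spanned by `{C_w : w ∈ K}`,
realized as finitely supported functions on the subtype `K`. -/
noncomputable def Cvec (F : Type*) [Field F] (K : Set W) (w : W) (hw : w ∈ K) : ↥K →₀ F :=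
  Finsupp.single ⟨w, hw⟩ 1

/-- An abstract Young (AY) pair: a representation `ρ` of `W` on `V_K` together with
coefficients `a, b` satisfying Axiom (A). -/
structure AYPair (cs : CoxeterSystem M W) (F : Type*) [Field F] (K : Set W) where
  ρ : Representation F W (↥K →₀ F)
  a : B → W → F
  b : B → W → F
  axiomA_mem : ∀ (i : B) (w : W) (hw : w ∈ K) (h : w * cs.simple i ∈ K),
    ρ (cs.simple i) (Cvec F K w hw) =
      a i w • Cvec F K w hw + b i w • Cvec F K (w * cs.simple i) h
  axiomA_not_mem : ∀ (i : B) (w : W) (hw : w ∈ K), w * cs.simple i ∉ K →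
    ρ (cs.simple i) (Cvec F K w hw) = a i w • Cvec F K w hw
  b_eq_zero : ∀ (i : B) (w : W), w ∈ K → w * cs.simple i ∉ K → b i w = 0

/-- A path in the right Cayley graph starting at `v`, given by a list of generators `l`,
is `ρ`-feasible if all its arcs `v·s₁⋯sₙ → v·s₁⋯sₙ₊₁` are `ρ`-feasible: both endpoints
lie in `K` and the corresponding `b`-coefficient is nonzero. -/
def FeasiblePath {cs : CoxeterSystem M W} {F : Type*} [Field F] {K : Set W}
    (P : AYPair cs F K) (v : W) (l : List B) : Prop :=
  ∀ (n : ℕ) (hn : n < l.length),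
    v * cs.wordProd (l.take n) ∈ K ∧
    v * cs.wordProd (l.take (n + 1)) ∈ K ∧
    P.b (l.get ⟨n, hn⟩) (v * cs.wordProd (l.take n)) ≠ 0

/-- The coefficient of `C_x` in `f`, understood to be zero when `x ∉ K`. -/
noncomputable def coeffAt {X F : Type*} [Field F] {K : Set X} (f : ↥K →₀ F) (x : X) : F :=
  open Classical in if h : x ∈ K then f ⟨x, h⟩ else 0

theorem coeffAt_of_notMem {X F : Type*} [Field F] {K : Set X} (f : ↥K →₀ F) {x : X} (h : x ∉ K) :
    coeffAt f x = 0 := dif_neg h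

theorem coeffAt_add {X F : Type*} [Field F] {K : Set X} (f g : ↥K →₀ F) (x : X) :
    coeffAt (f + g) x = coeffAt f x + coeffAt g x := by
  by_cases h : x ∈ K <;> simp [coeffAt, h]

theorem coeffAt_smul {X F : Type*} [Field F] {K : Set X} (c : F) (f : ↥K →₀ F) (x : X) :
    coeffAt (c • f) x = c * coeffAt f x := by
  by_cases h : x ∈ K <;> simp [coeffAt, h]

open Classical in
theorem coeffAt_Cvec {X F : Type*} [Field F] {K : Set X} {w : X} (hw : w ∈ K) (x : X) :
    coeffAt (Cvec F K w hw) x = if w = x then 1 else 0 := by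
  by_cases h : x ∈ K
  · simp [coeffAt, h, Cvec, Finsupp.single_apply]
  · have hne : w ≠ x := fun e => h (e ▸ hw)
    simp [coeffAt, h, hne]

theorem coeffAt_simple {cs : CoxeterSystem M W} {F : Type*} [Field F] {K : Set W}
    (P : AYPair cs F K) (i : B) (f : ↥K →₀ F) {z : W} (hz : z ∈ K) :
    coeffAt (P.ρ (cs.simple i) f) z =
      P.a i z * coeffAt f z + P.b i (z * cs.simple i) * coeffAt f (z * cs.simple i) := by
  induction f using Finsupp.induction_linear with
  | zero =>
    have h0 (x : W) : coeffAt (0 : ↥K →₀ F) x = 0 := by simp [coeffAt]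
    simp [h0]
  | add f g hf hg =>
    simp only [map_add, coeffAt_add, hf, hg]
    ring
  | single w c =>
    obtain ⟨w, hw⟩ := w
    have hc : Finsupp.single (⟨w, hw⟩ : ↥K) c = c • Cvec F K w hw := by simp [Cvec]
    have hne : cs.simple i ≠ 1 := by
      intro h
      have := cs.length_simple i
      simp [h] at this
    rw [hc, map_smul]
    by_cases h : w * cs.simple i ∈ K
    · rw [P.axiomA_mem i w hw h]
      simp only [coeffAt_smul, coeffAt_add, coeffAt_Cvec]
      by_cases h1 : w = z
      · subst h1
        simp [hne]
        ring
      · by_cases h2 : w = z * cs.simple i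
        · subst h2
          simp [hne]
          ring
        · have h3 : w * cs.simple i ≠ z := by
            rintro rfl
            simp at h2
          simp [h1, h2, h3]
    · rw [P.axiomA_not_mem i w hw h]
      have h2 : w ≠ z * cs.simple i := by
        rintro rfl
        exact h (by simpa using hz)
      simp only [coeffAt_smul, coeffAt_Cvec, if_neg h2]
      by_cases h1 : w = z
      · subst h1
        simp
        ring
      · simp [h1]

theorem coeffAt_wordProd_eq_zero {cs : CoxeterSystem M W} {F : Type*} [Field F] {K : Set W}
    (P : AYPair cs F K) {v : W} (hv : v ∈ K) (l : List B) (x : W) (hx : l.length < cs.length x) :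
    coeffAt (P.ρ (cs.wordProd l)⁻¹ (Cvec F K v hv)) (v * x) = 0 := by
  induction l using List.reverseRecOn generalizing x with
  | nil =>
    have : x ≠ 1 := by
      rintro rfl
      simp at hx
    simp [coeffAt_Cvec, this]
  | append_singleton l i ih =>
    by_cases hz : v * x ∈ K
    · have hl : l.length < cs.length x ∧ l.length < cs.length (x * cs.simple i) := by
        have := cs.length_mul_simple x i
        simp at hx
        omega
      simp only [cs.wordProd_append, cs.wordProd_singleton, mul_inv_rev, cs.inv_simple, map_mul,
        Module.End.mul_apply]
      rw [coeffAt_simple P i _ hz, ih x hl.1, mul_assoc, ih _ hl.2]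
      simp
    · exact coeffAt_of_notMem _ hz

theorem feasiblePath_append_singleton {cs : CoxeterSystem M W} {F : Type*} [Field F] {K : Set W}
    (P : AYPair cs F K) (v : W) (l : List B) (i : B) :
    FeasiblePath P v (l ++ [i]) ↔ FeasiblePath P v l ∧ v * cs.wordProd l ∈ K ∧
      v * cs.wordProd (l ++ [i]) ∈ K ∧ P.b i (v * cs.wordProd l) ≠ 0 := by
  constructor
  · intro h
    refine ⟨fun n hn => ?_, ?_⟩
    · have := h n (by simp; omega)
      simpa [List.take_append_of_le_length hn.le,
        List.take_append_of_le_length (Nat.succ_le_of_lt hn), List.getElem_append_left hn] using this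
    · simpa [List.take_of_length_le] using h l.length (by simp)
  · rintro ⟨h, h'⟩ n hn
    rcases Nat.lt_or_ge n l.length with hn' | hn'
    · simpa [List.take_append_of_le_length hn'.le,
        List.take_append_of_le_length (Nat.succ_le_of_lt hn'),
        List.getElem_append_left hn'] using h n hn'
    · obtain rfl : n = l.length := by
        simp at hn
        omega
      simpa [List.take_of_length_le] using h'

/-- For a reduced word, feasibility of the path from `v` is detected by the coefficient at its
endpoint in the image of `C_v` under the group element `(wordProd l)⁻¹`. -/
theorem feasiblePath_iff_coeffAt_ne_zero {cs : CoxeterSystem M W} {F : Type*} [Field F]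
    {K : Set W} (P : AYPair cs F K) {v : W} (hv : v ∈ K) {l : List B} (hl : cs.IsReduced l) :
    FeasiblePath P v l ↔
      coeffAt (P.ρ (cs.wordProd l)⁻¹ (Cvec F K v hv)) (v * cs.wordProd l) ≠ 0 := by
  induction l using List.reverseRecOn with
  | nil => simp [FeasiblePath, coeffAt_Cvec]
  | append_singleton l i ih =>
    have hl' : cs.IsReduced l := by simpa using hl.take l.length
    rw [feasiblePath_append_singleton, ih hl']
    by_cases hz : v * cs.wordProd (l ++ [i]) ∈ K
    · have key : coeffAt (P.ρ (cs.wordProd (l ++ [i]))⁻¹ (Cvec F K v hv))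
          (v * cs.wordProd (l ++ [i])) = P.b i (v * cs.wordProd l) *
            coeffAt (P.ρ (cs.wordProd l)⁻¹ (Cvec F K v hv)) (v * cs.wordProd l) := by
        have h0 := coeffAt_wordProd_eq_zero P hv l (cs.wordProd (l ++ [i]))
          (by rw [hl.eq]; simp)
        have he : v * cs.wordProd (l ++ [i]) * cs.simple i = v * cs.wordProd l := by
          simp [cs.wordProd_append, ← mul_assoc]
        have hρ : P.ρ (cs.wordProd (l ++ [i]))⁻¹ (Cvec F K v hv) =
            P.ρ (cs.simple i) (P.ρ (cs.wordProd l)⁻¹ (Cvec F K v hv)) := by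
          simp [cs.wordProd_append]
        rw [hρ, coeffAt_simple P i _ hz, h0, he, mul_zero, zero_add]
      rw [key, mul_ne_zero_iff]
      refine ⟨fun h => ⟨h.2.2.2, h.1⟩, fun h => ⟨h.2, ?_, hz, h.1⟩⟩
      by_contra hK
      exact h.2 (coeffAt_of_notMem _ hK)
    · simp [hz, coeffAt_of_notMem]

/-- if there is a `ρ`-feasible geodesic from `v` to `w`, then every geodesic
in `X(W,S)` from `v` to `w` is `ρ`-feasible. -/
theorem stmt0 (cs : CoxeterSystem M W) (F : Type*) [Field F] (K : Set W)
    (P : AYPair cs F K) (v w : W) (hv : v ∈ K) (hw : w ∈ K)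
    (hex : ∃ l : List B, v * cs.wordProd l = w ∧ l.length = cs.length (v⁻¹ * w) ∧
      FeasiblePath P v l) :
    ∀ l : List B, v * cs.wordProd l = w → l.length = cs.length (v⁻¹ * w) →
      FeasiblePath P v l := by
  obtain ⟨l₀, hl₀, hlen₀, hf⟩ := hex
  intro l hl hlen
  have h₀ : cs.wordProd l₀ = v⁻¹ * w := by rw [← hl₀, inv_mul_cancel_left]
  have h : cs.wordProd l = cs.wordProd l₀ := mul_left_cancel (hl.trans hl₀.symm)
  rw [feasiblePath_iff_coeffAt_ne_zero P hv (by rw [CoxeterSystem.IsReduced, h₀, hlen₀])] at hf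
  rwa [feasiblePath_iff_coeffAt_ne_zero P hv (by rw [CoxeterSystem.IsReduced, h, h₀, hlen]), h]
end

section
/- Every minimal AY cell is convex: if (ρ,K) is a minimal AY pair for the Coxeter system (W,S), then K is a convex subset of W in the right Cayley graph X(W,S) (equivalently, under right weak Bruhat order). -/
open CoxeterSystem

variable {B W : Type*} [Group W] {M : CoxeterMatrix B}

/-- The span of `{C_w : w ∈ K'}` inside `V_K`. -/
noncomputable def spanOf (F : Type*) [Field F] (K : Set W) (K' : Set W) :
    Submodule F (↥K →₀ F) :=
  Submodule.span F {x | ∃ (w : W) (h : w ∈ K), w ∈ K' ∧ x = Cvec F K w h}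

/-- Minimality of an AY pair: `K` is nonempty and it has no proper nonempty subset `K'`
such that `span{C_w : w ∈ K'}` is `ρ`-invariant. -/
def AYPair.Minimal {cs : CoxeterSystem M W} {F : Type*} [Field F] {K : Set W}
    (P : AYPair cs F K) : Prop :=
  K.Nonempty ∧ ∀ K' : Set W, K' ⊆ K → K'.Nonempty →
    (∀ (g : W), ∀ x ∈ spanOf F K K', P.ρ g x ∈ spanOf F K K') → K' = K

/-- A subset `K` of `W` is convex in the right Cayley graph: for all `x, y ∈ K`,
every geodesic from `x` to `y` has all of its vertices in `K`. -/
def IsConvex (cs : CoxeterSystem M W) (K : Set W) : Prop :=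
  ∀ x ∈ K, ∀ y ∈ K, ∀ l : List B, x * cs.wordProd l = y →
    l.length = cs.length (x⁻¹ * y) →
    ∀ n ≤ l.length, x * cs.wordProd (l.take n) ∈ K

namespace AYPair

variable {cs : CoxeterSystem M W} {F : Type*} [Field F] {K : Set W}

section Coeff

variable {X : Type*} {L : Set X}

/-- The coefficient of `C_u` in `v`, taken to be zero if `u` does not index a basis vector. -/
noncomputable def coeff (v : ↥L →₀ F) (u : X) : F :=
  Finsupp.lmapDomain F F (Subtype.val : ↥L → X) v u

theorem coeff_add (v v' : ↥L →₀ F) (u : X) : coeff (v + v') u = coeff v u + coeff v' u := by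
  simp only [coeff, map_add, Finsupp.add_apply]

theorem coeff_smul (c : F) (v : ↥L →₀ F) (u : X) : coeff (c • v) u = c * coeff v u := by
  simp only [coeff, map_smul, Finsupp.smul_apply, smul_eq_mul]

theorem coeff_Cvec (w : X) (hw : w ∈ L) (u : X) :
    coeff (Cvec F L w hw) u = Finsupp.single w (1 : F) u := by
  simp [coeff, Cvec]

theorem coeff_eq_zero (v : ↥L →₀ F) {u : X} (hu : u ∉ L) : coeff v u = 0 :=
  Finsupp.mapDomain_of_notMem_range _ _ (by simpa using hu)

end Coeff

theorem coeff_simple (P : AYPair cs F K) (i : B) (v : ↥K →₀ F) (u : W) :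
    coeff (P.ρ (cs.simple i) v) u =
      P.a i u * coeff v u + P.b i (u * cs.simple i) * coeff v (u * cs.simple i) := by
  classical
  induction v using Finsupp.induction_linear with
  | zero => simp [coeff]
  | add v v' hv hv' => rw [map_add, coeff_add, coeff_add, coeff_add, hv, hv']; ring
  | single w c =>
    obtain ⟨w, hw⟩ := w
    have hc : (Finsupp.single ⟨w, hw⟩ c : ↥K →₀ F) = c • Cvec F K w hw := by simp [Cvec]
    have key : coeff (P.ρ (cs.simple i) (Cvec F K w hw)) u =
        P.a i w * Finsupp.single w (1 : F) u +
          P.b i w * Finsupp.single (w * cs.simple i) (1 : F) u := by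
      by_cases h : w * cs.simple i ∈ K
      · rw [P.axiomA_mem i w hw h, coeff_add, coeff_smul, coeff_smul, coeff_Cvec, coeff_Cvec]
      · rw [P.axiomA_not_mem i w hw h, coeff_smul, coeff_Cvec, P.b_eq_zero i w hw h]
        ring
    have hiff : w * cs.simple i = u ↔ w = u * cs.simple i := by
      constructor
      · rintro rfl; simp
      · rintro rfl; simp
    rw [hc, map_smul, coeff_smul, coeff_smul, coeff_smul, key, coeff_Cvec, coeff_Cvec]
    simp only [Finsupp.single_apply, hiff]
    split_ifs with h₁ h₂ h₂
    · subst h₁; rw [← h₂]; ring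
    · subst h₁; ring
    · rw [← h₂]; ring
    · ring

/-- The coefficient of `C_{xg}` in `ρ(g⁻¹) C_x`. -/
noncomputable def lead (P : AYPair cs F K) (x : W) (hx : x ∈ K) (g : W) : F :=
  coeff (P.ρ g⁻¹ (Cvec F K x hx)) (x * g)

theorem rho_mul_simple_inv (P : AYPair cs F K) (g : W) (i : B) (v : ↥K →₀ F) :
    P.ρ (g * cs.simple i)⁻¹ v = P.ρ (cs.simple i) (P.ρ g⁻¹ v) := by
  rw [mul_inv_rev, cs.inv_simple, map_mul, Module.End.mul_apply]

theorem coeff_rho_wordProd_inv_eq_zero (P : AYPair cs F K) {x : W} (hx : x ∈ K) (l : List B) :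
    ∀ u : W, l.length < cs.length u →
      coeff (P.ρ (cs.wordProd l)⁻¹ (Cvec F K x hx)) (x * u) = 0 := by
  induction l using List.reverseRecOn with
  | nil =>
    intro u hu
    have hne : u ≠ 1 := by rintro rfl; simp at hu
    simp only [cs.wordProd_nil, inv_one, map_one, Module.End.one_apply, coeff_Cvec]
    exact Finsupp.single_eq_of_ne (by simpa using hne)
  | append_singleton l i ih =>
    intro u hu
    rw [List.length_append, List.length_singleton] at hu
    have hlen : l.length < cs.length (u * cs.simple i) := by
      rcases cs.length_mul_simple u i with h | h <;> omega
    rw [cs.wordProd_append, cs.wordProd_singleton, rho_mul_simple_inv, coeff_simple, mul_assoc x,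
      ih u (by omega), ih _ hlen]
    ring

theorem lead_mul_simple (P : AYPair cs F K) {x : W} (hx : x ∈ K) (g : W) (i : B)
    (h : cs.length g < cs.length (g * cs.simple i)) :
    P.lead x hx (g * cs.simple i) = P.b i (x * g) * P.lead x hx g := by
  obtain ⟨l, hl, rfl⟩ := cs.exists_isReduced g
  rw [lead, rho_mul_simple_inv, coeff_simple,
    P.coeff_rho_wordProd_inv_eq_zero hx l _ (hl.eq ▸ h)]
  simp [lead, ← mul_assoc]

theorem lead_one (P : AYPair cs F K) {x : W} (hx : x ∈ K) : P.lead x hx 1 = 1 := by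
  simp [lead, coeff_Cvec]

/-- A set of basis vectors closed under the arcs of nonzero `b`-coefficient spans an invariant
subspace. -/
theorem invariant_of_closed (P : AYPair cs F K) {K' : Set W}
    (hcl : ∀ w ∈ K', ∀ i, w * cs.simple i ∈ K → P.b i w ≠ 0 → w * cs.simple i ∈ K') (g : W) :
    ∀ v ∈ spanOf F K K', P.ρ g v ∈ spanOf F K K' := by
  have hmem : ∀ w (hw : w ∈ K), w ∈ K' → Cvec F K w hw ∈ spanOf F K K' :=
    fun w hw hw' => Submodule.subset_span ⟨w, hw, hw', rfl⟩
  induction g using cs.simple_induction with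
  | simple i =>
    intro v hv
    refine Submodule.span_induction (p := fun v _ => P.ρ (cs.simple i) v ∈ spanOf F K K')
      ?_ ?_ ?_ ?_ hv
    · rintro _ ⟨w, hw, hw', rfl⟩
      by_cases h : w * cs.simple i ∈ K
      · rw [P.axiomA_mem i w hw h]
        refine add_mem (Submodule.smul_mem _ _ (hmem w hw hw')) ?_
        by_cases hb : P.b i w = 0
        · simp [hb]
        · exact Submodule.smul_mem _ _ (hmem _ h (hcl w hw' i h hb))
      · rw [P.axiomA_not_mem i w hw h]
        exact Submodule.smul_mem _ _ (hmem w hw hw')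
    · simp
    · intro v v' _ _ h h'
      rw [map_add]
      exact add_mem h h'
    · intro c v _ h
      rw [map_smul]
      exact Submodule.smul_mem _ _ h
  | one => simp
  | mul g g' hg hg' =>
    intro v hv
    rw [map_mul, Module.End.mul_apply]
    exact hg _ (hg' _ hv)

theorem Minimal.lead_ne_zero {P : AYPair cs F K} (hmin : P.Minimal) {x : W} (hx : x ∈ K)
    {y : W} (hy : y ∈ K) : P.lead x hx (x⁻¹ * y) ≠ 0 := by
  have hK : {y | y ∈ K ∧ P.lead x hx (x⁻¹ * y) ≠ 0} = K := by
    refine hmin.2 _ (fun _ h => h.1) ⟨x, hx, by simp [lead_one]⟩ (P.invariant_of_closed ?_)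
    rintro w ⟨-, hw⟩ i hwi hb
    refine ⟨hwi, ?_⟩
    rw [← mul_assoc]
    rcases cs.length_mul_simple (x⁻¹ * w) i with h | h
    · rw [P.lead_mul_simple hx _ i (by omega), mul_inv_cancel_left]
      exact mul_ne_zero hb hw
    · have h' := P.lead_mul_simple hx (x⁻¹ * w * cs.simple i) i
        (by rw [cs.simple_mul_simple_cancel_right]; omega)
      rw [cs.simple_mul_simple_cancel_right] at h'
      exact right_ne_zero_of_mul (h' ▸ hw)
  exact (hK.symm ▸ hy : y ∈ {y | y ∈ K ∧ P.lead x hx (x⁻¹ * y) ≠ 0}).2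

theorem lead_take_ne_zero (P : AYPair cs F K) {x : W} (hx : x ∈ K) (l : List B) :
    cs.IsReduced l → P.lead x hx (cs.wordProd l) ≠ 0 →
      ∀ n, P.lead x hx (cs.wordProd (l.take n)) ≠ 0 := by
  induction l using List.reverseRecOn with
  | nil => intro _ h n; simpa using h
  | append_singleton l i ih =>
    intro hl h n
    rcases Nat.lt_or_ge l.length n with hn | hn
    · rwa [List.take_of_length_le (by simpa using hn)]
    · have hl' : cs.IsReduced l := by simpa using hl.take l.length
      have hlen := hl.eq
      have hlen' := hl'.eq
      rw [List.length_append, List.length_singleton, cs.wordProd_append,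
        cs.wordProd_singleton] at hlen
      rw [cs.wordProd_append, cs.wordProd_singleton,
        P.lead_mul_simple hx _ i (by omega)] at h
      rw [List.take_append_of_le_length hn]
      exact ih hl' (right_ne_zero_of_mul h) n

end AYPair

/-- every minimal AY cell is convex. -/
theorem stmt2 (cs : CoxeterSystem M W) (F : Type*) [Field F] (K : Set W)
    (P : AYPair cs F K) (hmin : P.Minimal) :
    IsConvex cs K := by
  rintro x hx y hy l rfl hlen n -
  have hlead := hmin.lead_ne_zero hx hy
  rw [inv_mul_cancel_left] at hlen hlead
  by_contra h
  exact P.lead_take_ne_zero hx l hlen.symm hlead n (AYPair.coeff_eq_zero _ h)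
end

section
/- An AY pair (ρ,K) for the Coxeter system (W,S) with K ≠ ∅ is strongly connected (i.e., for all v,w ∈ K there exists a ρ-feasible path from v to w) if and only if it is minimal. -/
open CoxeterSystem

variable {B W : Type*} [Group W] {M : CoxeterMatrix B}

/-- An AY pair is strongly connected if any two elements of `K` are joined by a
`ρ`-feasible path. -/
def AYPair.StronglyConnected {cs : CoxeterSystem M W} {F : Type*} [Field F] {K : Set W}
    (P : AYPair cs F K) : Prop :=
  ∀ v ∈ K, ∀ w ∈ K, ∃ l : List B, v * cs.wordProd l = w ∧ FeasiblePath P v l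

/-- The arc relation of `ρ`-feasible arcs between elements of `K`. -/
def AYPair.FeasibleArc {cs : CoxeterSystem M W} {F : Type*} [Field F] {K : Set W}
    (P : AYPair cs F K) (v w : W) : Prop :=
  ∃ i : B, w = v * cs.simple i ∧ v ∈ K ∧ w ∈ K ∧ P.b i v ≠ 0

theorem feasiblePath_cons {cs : CoxeterSystem M W} {F : Type*} [Field F] {K : Set W}
    (P : AYPair cs F K) (v : W) (i : B) (l : List B) :
    FeasiblePath P v (i :: l) ↔
      (v ∈ K ∧ v * cs.simple i ∈ K ∧ P.b i v ≠ 0) ∧ FeasiblePath P (v * cs.simple i) l := by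
  constructor
  · intro h
    refine ⟨by simpa [cs.wordProd_cons] using h 0 (by simp), fun n hn => ?_⟩
    simpa [cs.wordProd_cons, mul_assoc] using h (n + 1) (by simpa using hn)
  · rintro ⟨h₀, h⟩ n hn
    cases n with
    | zero => simpa [cs.wordProd_cons] using h₀
    | succ n => simpa [cs.wordProd_cons, mul_assoc] using h n (by simpa using hn)

theorem exists_feasiblePath_iff {cs : CoxeterSystem M W} {F : Type*} [Field F] {K : Set W}
    (P : AYPair cs F K) (v w : W) :
    (∃ l : List B, v * cs.wordProd l = w ∧ FeasiblePath P v l) ↔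
      Relation.ReflTransGen P.FeasibleArc v w := by
  constructor
  · rintro ⟨l, hl, h⟩
    induction l generalizing v with
    | nil =>
      obtain rfl : v = w := by simpa using hl
      exact .refl
    | cons i l ih =>
      obtain ⟨⟨hv, hvi, hb⟩, h⟩ := (feasiblePath_cons P v i l).1 h
      exact .head ⟨i, rfl, hv, hvi, hb⟩
        (ih _ (by rw [← hl, cs.wordProd_cons, mul_assoc]) h)
  · intro h
    induction h using Relation.ReflTransGen.head_induction_on with
    | refl => exact ⟨[], by simp, fun n hn => absurd hn (by simp)⟩
    | head h _ ih =>
      obtain ⟨i, rfl, hv, hvi, hb⟩ := h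
      obtain ⟨l, hl, hp⟩ := ih
      exact ⟨i :: l, by rw [← hl, cs.wordProd_cons, mul_assoc],
        (feasiblePath_cons P _ i l).2 ⟨⟨hv, hvi, hb⟩, hp⟩⟩

theorem Cvec_mem_spanOf (F : Type*) [Field F] {X : Type*} {K K' : Set X} {w : X}
    (hw : w ∈ K) (hw' : w ∈ K') : Cvec F K w hw ∈ spanOf F K K' :=
  Submodule.subset_span ⟨w, hw, hw', rfl⟩

theorem apply_eq_zero_of_mem_spanOf {F : Type*} [Field F] {X : Type*} {K K' : Set X}
    {x : ↥K →₀ F} (hx : x ∈ spanOf F K K') (w : ↥K) (hw : (w : X) ∉ K') : x w = 0 := by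
  induction hx using Submodule.span_induction with
  | mem x hx =>
    obtain ⟨u, hu, hu', rfl⟩ := hx
    refine Finsupp.single_eq_of_ne ?_
    rintro rfl
    exact hw hu'
  | zero => rfl
  | add x y _ _ hx hy => simp [hx, hy]
  | smul c x _ hx => simp [hx]

/-- A coordinate subspace is `ρ`-invariant iff its index set is closed under feasible arcs. -/
theorem spanOf_invariant_iff {cs : CoxeterSystem M W} {F : Type*} [Field F] {K : Set W}
    (P : AYPair cs F K) (K' : Set W) :
    (∀ g : W, ∀ x ∈ spanOf F K K', P.ρ g x ∈ spanOf F K K') ↔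
      ∀ v w, P.FeasibleArc v w → v ∈ K' → w ∈ K' := by
  constructor
  · rintro h v _ ⟨i, rfl, hv, hvi, hb⟩ hv'
    by_contra hvi'
    have hne : v ≠ v * cs.simple i := fun e => hvi' (e ▸ hv')
    have h₀ := apply_eq_zero_of_mem_spanOf (h (cs.simple i) _ (Cvec_mem_spanOf F hv hv'))
      ⟨_, hvi⟩ hvi'
    rw [P.axiomA_mem i v hv hvi] at h₀
    simp only [Cvec, Finsupp.add_apply, Finsupp.smul_apply, Finsupp.single_eq_same,
      smul_eq_mul, mul_one] at h₀
    rw [Finsupp.single_eq_of_ne (fun e => hne (congrArg Subtype.val e).symm)] at h₀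
    exact hb (by simpa using h₀)
  · intro h g
    induction g using cs.simple_induction with
    | simple i =>
      intro x hx
      induction hx using Submodule.span_induction with
      | mem x hx =>
        obtain ⟨v, hv, hv', rfl⟩ := hx
        have ha := (spanOf F K K').smul_mem (P.a i v) (Cvec_mem_spanOf F hv hv')
        by_cases hvi : v * cs.simple i ∈ K
        · rw [P.axiomA_mem i v hv hvi]
          refine add_mem ha ?_
          by_cases hb : P.b i v = 0
          · simp [hb]
          · exact Submodule.smul_mem _ _
              (Cvec_mem_spanOf F hvi (h _ _ ⟨i, rfl, hv, hvi, hb⟩ hv'))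
        · rwa [P.axiomA_not_mem i v hv hvi]
      | zero => simp
      | add x y _ _ hx hy => simpa using add_mem hx hy
      | smul c x _ hx => simpa using Submodule.smul_mem _ c hx
    | one => simp
    | mul g₁ g₂ h₁ h₂ =>
      intro x hx
      simpa using h₁ _ (h₂ _ hx)

/-- an AY pair with nonempty cell is strongly connected iff it is minimal. -/
theorem stmt4 (cs : CoxeterSystem M W) (F : Type*) [Field F] (K : Set W)
    (P : AYPair cs F K) (hK : K.Nonempty) :
    P.StronglyConnected ↔ P.Minimal := by
  simp only [AYPair.StronglyConnected, AYPair.Minimal, exists_feasiblePath_iff,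
    spanOf_invariant_iff]
  constructor
  · refine fun h => ⟨hK, fun K' hK' ⟨v, hv⟩ hcl => hK'.antisymm fun w hw => ?_⟩
    induction h v (hK' hv) w hw with
    | refl => exact hv
    | tail _ hbc ih => exact hcl _ _ hbc (ih hbc.choose_spec.2.1)
  · rintro ⟨-, h⟩ v hv w hw
    have hreach := h {u ∈ K | Relation.ReflTransGen P.FeasibleArc v u} (fun u hu => hu.1)
      ⟨v, hv, .refl⟩ fun u u' hu hvu => ⟨hu.choose_spec.2.2.1, hvu.2.tail hu⟩
    exact (hreach.symm ▸ hw : w ∈ {u ∈ K | Relation.ReflTransGen P.FeasibleArc v u}).2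
end

section
/- Let (W,S) be a Coxeter system, A ⊆ T a set of reflections, and u,v ∈ W. Then u ∼_A v if and only if Des_A(u) = Des_A(v). -/
open CoxeterSystem

variable {B W : Type*} [Group W] {M : CoxeterMatrix B}

/-- The `A`-descent set of `w`: the reflections `t ∈ A` with `ℓ(tw) < ℓ(w)`. -/
def DesSet (cs : CoxeterSystem M W) (A : Set W) (w : W) : Set W :=
  {t | t ∈ A ∧ cs.length (t * w) < cs.length w}

/-- The relation `w ↔_A ws`: one step along an edge `{w, ws}` of the right Cayley graph
with `w s w⁻¹ ∉ A`.  (This relation is symmetric.) -/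
def AAdj (cs : CoxeterSystem M W) (A : Set W) (u v : W) : Prop :=
  ∃ i : B, v = u * cs.simple i ∧ u * cs.simple i * u⁻¹ ∉ A

/-- The relation `∼_A`: the reflexive-transitive closure of `↔_A`. -/
def ASim (cs : CoxeterSystem M W) (A : Set W) : W → W → Prop :=
  Relation.ReflTransGen (AAdj cs A)

lemma functionEnd_mul_apply {α : Type*} (f g : Function.End α) (x : α) : (f * g) x = f (g x) := rfl

open scoped Classical in
/-- The reflection representation of a generator on `W × ℤ/2`: conjugate the first coordinate, and
flip the sign exactly when the first coordinate is the generator itself. -/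
noncomputable def signedConj (cs : CoxeterSystem M W) (i : B) : Function.End (W × ZMod 2) :=
  fun p ↦ (cs.simple i * p.1 * cs.simple i, p.2 + if p.1 = cs.simple i then 1 else 0)

lemma simple_mul_pow_mul_simple (cs : CoxeterSystem M W) (i j : B) (n : ℕ) :
    cs.simple j * (cs.simple i * cs.simple j) ^ n * cs.simple j
      = ((cs.simple i * cs.simple j) ^ n)⁻¹ := by
  have h := conj_pow (i := n) (a := cs.simple j) (b := cs.simple i * cs.simple j)
  rw [cs.inv_simple] at h
  rw [← h, ← inv_pow]
  simp [mul_assoc]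

lemma conj_pow_eq_simple_iff (cs : CoxeterSystem M W) (i j : B) (n : ℕ) (t : W) :
    (cs.simple i * cs.simple j) ^ n * t * ((cs.simple i * cs.simple j) ^ n)⁻¹ = cs.simple j ↔
      t = cs.simple j * (cs.simple i * cs.simple j) ^ (2 * n) := by
  have h : cs.simple j * (cs.simple i * cs.simple j) ^ (2 * n) =
      ((cs.simple i * cs.simple j) ^ n)⁻¹ * cs.simple j * (cs.simple i * cs.simple j) ^ n := by
    rw [← simple_mul_pow_mul_simple, two_mul, pow_add]
    simp [mul_assoc]
  rw [h, mul_inv_eq_iff_eq_mul, mul_assoc _ (cs.simple j), eq_inv_mul_iff_mul_eq]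

lemma simple_conj_conj_pow_eq_simple_iff (cs : CoxeterSystem M W) (i j : B) (n : ℕ) (t : W) :
    cs.simple j * ((cs.simple i * cs.simple j) ^ n * t * ((cs.simple i * cs.simple j) ^ n)⁻¹)
        * cs.simple j = cs.simple i ↔
      t = cs.simple j * (cs.simple i * cs.simple j) ^ (2 * n + 1) := by
  have h : cs.simple j * (cs.simple i * cs.simple j) ^ (2 * n + 1) =
      ((cs.simple i * cs.simple j) ^ n)⁻¹ * (cs.simple j * cs.simple i * cs.simple j)
        * (cs.simple i * cs.simple j) ^ n := by
    rw [← simple_mul_pow_mul_simple, show 2 * n + 1 = n + 1 + n by ring, pow_add, pow_succ]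
    simp [mul_assoc]
  rw [h, mul_assoc ((_ : W)⁻¹), eq_inv_mul_iff_mul_eq, ← mul_inv_eq_iff_eq_mul]
  generalize (cs.simple i * cs.simple j) ^ n = r
  constructor
  · intro h
    rw [← h]
    simp [mul_assoc]
  · intro h
    rw [h]
    simp [mul_assoc]

open scoped Classical in
lemma signedConj_mul_pow_apply (cs : CoxeterSystem M W) (i j : B) (n : ℕ) (p : W × ZMod 2) :
    ((signedConj cs i * signedConj cs j) ^ n) p =
      ((cs.simple i * cs.simple j) ^ n * p.1 * ((cs.simple i * cs.simple j) ^ n)⁻¹,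
        p.2 + ∑ k ∈ Finset.range (2 * n),
          if p.1 = cs.simple j * (cs.simple i * cs.simple j) ^ k then 1 else 0) := by
  induction n with
  | zero => simp [Function.End.one_def]
  | succ n ih =>
    rw [pow_succ', functionEnd_mul_apply, ih, functionEnd_mul_apply, signedConj, signedConj]
    simp only [conj_pow_eq_simple_iff, simple_conj_conj_pow_eq_simple_iff]
    rw [show 2 * (n + 1) = 2 * n + 1 + 1 by ring, Finset.sum_range_succ, Finset.sum_range_succ]
    refine Prod.ext ?_ ?_
    · simp [pow_succ' _ n, mul_assoc]
    · simp only [add_assoc]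

lemma isLiftable_signedConj (cs : CoxeterSystem M W) : M.IsLiftable (signedConj cs) := by
  classical
  intro i j
  funext p
  rw [signedConj_mul_pow_apply, two_mul, Finset.sum_range_add]
  simp only [pow_add, cs.simple_mul_simple_pow, one_mul, inv_one, mul_one, CharTwo.add_self_eq_zero,
    add_zero]
  rfl

/-- The reflection representation of `W` on `W × ℤ/2`. -/
noncomputable def signedConjHom (cs : CoxeterSystem M W) : W →* Function.End (W × ZMod 2) :=
  cs.lift ⟨signedConj cs, isLiftable_signedConj cs⟩

lemma signedConjHom_simple (cs : CoxeterSystem M W) (i : B) :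
    signedConjHom cs (cs.simple i) = signedConj cs i :=
  cs.lift_apply_simple (isLiftable_signedConj cs) i

open scoped Classical in
lemma signedConjHom_wordProd (cs : CoxeterSystem M W) (ω : List B) (p : W × ZMod 2) :
    signedConjHom cs (cs.wordProd ω) p =
      (cs.wordProd ω * p.1 * (cs.wordProd ω)⁻¹, p.2 + ((cs.rightInvSeq ω).count p.1 : ZMod 2)) := by
  induction ω with
  | nil => simp [Function.End.one_def]
  | cons i ω ih =>
    rw [cs.wordProd_cons, map_mul, functionEnd_mul_apply, ih,
      signedConjHom_simple, signedConj]
    refine Prod.ext ?_ ?_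
    · simp [mul_assoc]
    · have h : cs.wordProd ω * p.1 * (cs.wordProd ω)⁻¹ = cs.simple i ↔
          (cs.wordProd ω)⁻¹ * cs.simple i * cs.wordProd ω = p.1 := by
        rw [mul_inv_eq_iff_eq_mul, mul_assoc _ (cs.simple i), inv_mul_eq_iff_eq_mul, eq_comm]
      simp only [rightInvSeq, List.count_cons, h, beq_iff_eq, Nat.cast_add, Nat.cast_ite,
        Nat.cast_one, Nat.cast_zero, add_assoc]

/-- The parity of the number of occurrences of `t` among the right inversions of any word for `w`. -/
noncomputable def inversionParity (cs : CoxeterSystem M W) (w t : W) : ZMod 2 :=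
  (signedConjHom cs w (t, 0)).2

open scoped Classical in
lemma inversionParity_wordProd (cs : CoxeterSystem M W) (ω : List B) (t : W) :
    inversionParity cs (cs.wordProd ω) t = ((cs.rightInvSeq ω).count t : ZMod 2) := by
  simp [inversionParity, signedConjHom_wordProd]

lemma signedConjHom_apply (cs : CoxeterSystem M W) (w : W) (p : W × ZMod 2) :
    signedConjHom cs w p = (w * p.1 * w⁻¹, p.2 + inversionParity cs w p.1) := by
  classical
  obtain ⟨ω, rfl⟩ := cs.wordProd_surjective w
  rw [inversionParity_wordProd, signedConjHom_wordProd]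

lemma inversionParity_mul (cs : CoxeterSystem M W) (u v t : W) :
    inversionParity cs (u * v) t =
      inversionParity cs v t + inversionParity cs u (v * t * v⁻¹) := by
  rw [inversionParity, map_mul, functionEnd_mul_apply, signedConjHom_apply,
    signedConjHom_apply]
  simp

lemma inversionParity_one (cs : CoxeterSystem M W) (t : W) : inversionParity cs 1 t = 0 := by
  simp [inversionParity, Function.End.one_def]

open scoped Classical in
lemma inversionParity_simple (cs : CoxeterSystem M W) (i : B) (t : W) :
    inversionParity cs (cs.simple i) t = if t = cs.simple i then 1 else 0 := by
  simp [inversionParity, signedConjHom_simple, signedConj]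

lemma inversionParity_self (cs : CoxeterSystem M W) {t : W} (ht : cs.IsReflection t) :
    inversionParity cs t t = 1 := by
  classical
  obtain ⟨w, i, rfl⟩ := ht
  have h := inversionParity_mul cs w w⁻¹ (w * cs.simple i * w⁻¹)
  rw [mul_inv_cancel, inversionParity_one] at h
  rw [inversionParity_mul, inversionParity_mul]
  simp only [inv_inv, mul_assoc, inv_mul_cancel_left, inv_mul_cancel, one_mul, mul_one,
    inversionParity_simple, cs.inv_simple, cs.simple_mul_simple_self, if_true] at h ⊢
  linear_combination -h

lemma length_mul_lt_of_inversionParity_eq_one (cs : CoxeterSystem M W) {w t : W}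
    (h : inversionParity cs w t = 1) : cs.length (w * t) < cs.length w := by
  classical
  obtain ⟨ω, hω, rfl⟩ := cs.exists_isReduced w
  rw [inversionParity_wordProd] at h
  refine (cs.isRightInversion_of_mem_rightInvSeq hω (t := t) ?_).2
  by_contra hn
  simp [List.count_eq_zero_of_not_mem hn] at h

/-- The strong exchange property, in terms of `inversionParity`. -/
lemma length_mul_lt_iff_inversionParity_eq_one (cs : CoxeterSystem M W) {w t : W}
    (ht : cs.IsReflection t) :
    cs.length (w * t) < cs.length w ↔ inversionParity cs w t = 1 := by
  refine ⟨fun hlt ↦ ?_, length_mul_lt_of_inversionParity_eq_one cs⟩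
  by_contra hne
  have h0 : inversionParity cs w t = 0 :=
    (by decide : ∀ x : ZMod 2, x ≠ 1 → x = 0) _ hne
  have h := length_mul_lt_of_inversionParity_eq_one cs (w := w * t) (t := t) (by
    rw [inversionParity_mul, inversionParity_self cs ht, mul_inv_cancel_right, h0, add_zero])
  rw [mul_assoc, ht.mul_self, mul_one] at h
  omega

lemma length_reflection_mul_lt_iff (cs : CoxeterSystem M W) {w t : W} (ht : cs.IsReflection t) :
    cs.length (t * w) < cs.length w ↔ inversionParity cs w⁻¹ t = 1 := by
  rw [← length_mul_lt_iff_inversionParity_eq_one cs ht, ← cs.length_inv (t * w), mul_inv_rev,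
    ht.inv, cs.length_inv w]

lemma desSet_eq_iff (cs : CoxeterSystem M W) {A : Set W} (hA : ∀ t ∈ A, cs.IsReflection t)
    (u v : W) : DesSet cs A u = DesSet cs A v ↔
      ∀ t ∈ A, inversionParity cs u⁻¹ t = inversionParity cs v⁻¹ t := by
  have key : ∀ x y : ZMod 2, x = y ↔ (x = 1 ↔ y = 1) := by decide
  simp only [Set.ext_iff, DesSet, Set.mem_ofPred_eq, and_congr_right_iff]
  refine forall₂_congr fun t ht ↦ ?_
  rw [length_reflection_mul_lt_iff cs (hA t ht), length_reflection_mul_lt_iff cs (hA t ht), ← key]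

lemma AAdj.inversionParity_eq {cs : CoxeterSystem M W} {A : Set W} {u v : W} (h : AAdj cs A u v)
    {t : W} (ht : t ∈ A) : inversionParity cs u⁻¹ t = inversionParity cs v⁻¹ t := by
  classical
  obtain ⟨i, rfl, hi⟩ := h
  rw [mul_inv_rev, inversionParity_mul, cs.inv_simple, inversionParity_simple, if_neg, add_zero]
  intro h
  refine hi ?_
  rw [← h]
  simpa [mul_assoc] using ht

/-- The path from `u` spelled by `ω` stays in the `A`-class of `u` if no reflection it crosses, a
`u`-conjugate of a left inversion of `ω`, lies in `A`. -/
lemma asim_mul_wordProd (cs : CoxeterSystem M W) (A : Set W) (ω : List B) (u : W)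
    (h : ∀ t ∈ cs.leftInvSeq ω, u * t * u⁻¹ ∉ A) : ASim cs A u (u * cs.wordProd ω) := by
  induction ω generalizing u with
  | nil =>
    rw [cs.wordProd_nil, mul_one]
    exact Relation.ReflTransGen.refl
  | cons i ω ih =>
    rw [cs.wordProd_cons, ← mul_assoc]
    refine Relation.ReflTransGen.head ⟨i, rfl, h _ (by simp [leftInvSeq])⟩
      (ih (u * cs.simple i) fun t ht ↦ ?_)
    have := h (MulAut.conj (cs.simple i) t)
      (List.mem_cons_of_mem _ (List.mem_map_of_mem ht))
    simpa [mul_assoc] using this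

/-- `u ∼_A v` iff `Des_A(u) = Des_A(v)`. -/
theorem stmt5 (cs : CoxeterSystem M W) (A : Set W)
    (hA : ∀ t ∈ A, cs.IsReflection t) (u v : W) :
    ASim cs A u v ↔ DesSet cs A u = DesSet cs A v := by
  rw [desSet_eq_iff cs hA]
  constructor
  · intro h t ht
    induction h with
    | refl => rfl
    | tail _ hstep ih => exact ih.trans (hstep.inversionParity_eq ht)
  · intro h
    obtain ⟨ω, hω, hprod⟩ := cs.exists_isReduced (u⁻¹ * v)
    have hv : v = u * cs.wordProd ω := by rw [← hprod, mul_inv_cancel_left]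
    rw [hv]
    refine asim_mul_wordProd cs A ω u fun t ht hmem ↦ ?_
    obtain ⟨hrefl, hlt⟩ := cs.isLeftInversion_of_mem_leftInvSeq hω ht
    rw [length_reflection_mul_lt_iff cs hrefl] at hlt
    have h' := h _ hmem
    rw [hv, mul_inv_rev, inversionParity_mul, inv_inv,
      show u⁻¹ * (u * t * u⁻¹) * u = t by simp [mul_assoc], hlt] at h'
    simp at h'
end

section
/- Let (W,S) be a Coxeter system and A ⊆ T a set of reflections. For every w ∈ W, the ∼_A-equivalence class of w equals the generalized descent class W_A^{Des_A(w)}; consequently, the equivalence classes of ∼_A are exactly the nonempty generalized descent classes W_A^D with D ⊆ A. -/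
open CoxeterSystem

variable {B W : Type*} [Group W] {M : CoxeterMatrix B}

namespace CoxeterSystem

variable (cs : CoxeterSystem M W)

open Classical in
/-- The involution `(t, e) ↦ (s t s, e + [t = s])` of `W × ZMod 2` attached to a simple
reflection `s`. -/
noncomputable def simpleReflectionPerm (i : B) : Equiv.Perm (W × ZMod 2) :=
  Function.Involutive.toPerm
    (fun p ↦ (cs.simple i * p.1 * cs.simple i, p.2 + if p.1 = cs.simple i then 1 else 0)) (by
      rintro ⟨t, e⟩
      have h : cs.simple i * t * cs.simple i = cs.simple i ↔ t = cs.simple i := by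
        constructor
        · intro h
          simpa [mul_assoc] using congrArg (fun x ↦ cs.simple i * x * cs.simple i) h
        · rintro rfl
          simp
      ext
      · simp [mul_assoc]
      · simp only [h, add_assoc, CharTwo.add_self_eq_zero, add_zero])

open Classical in
theorem simpleReflectionPerm_apply (i : B) (t : W) (e : ZMod 2) :
    cs.simpleReflectionPerm i (t, e) =
      (cs.simple i * t * cs.simple i, e + if t = cs.simple i then 1 else 0) := rfl

theorem pow_mul_simple_mul_pow (i j : B) (k : ℕ) :
    (cs.simple i * cs.simple j) ^ k * cs.simple j * (cs.simple i * cs.simple j) ^ k =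
      cs.simple j := by
  induction k with
  | zero => simp
  | succ k ih =>
    calc _ = (cs.simple i * cs.simple j) ^ k *
          (cs.simple i * (cs.simple j * cs.simple j) * cs.simple i * cs.simple j) *
          (cs.simple i * cs.simple j) ^ k := by
            nth_rewrite 2 [pow_succ']
            rw [pow_succ]
            simp only [mul_assoc]
      _ = _ := by simpa using ih

theorem conj_pow_eq_iff (i j : B) (k l : ℕ) (t : W) :
    (cs.simple i * cs.simple j) ^ k * t * ((cs.simple i * cs.simple j) ^ k)⁻¹ =
      cs.simple j * (cs.simple i * cs.simple j) ^ l ↔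
    t = cs.simple j * (cs.simple i * cs.simple j) ^ (2 * k + l) := by
  have h := cs.pow_mul_simple_mul_pow i j k
  set c := cs.simple i * cs.simple j
  have h' : c ^ k * (cs.simple j * c ^ (2 * k + l)) = cs.simple j * c ^ l * c ^ k := by
    rw [show 2 * k + l = k + (l + k) by ring, pow_add, pow_add]
    simpa only [mul_assoc] using congrArg (· * (c ^ l * c ^ k)) h
  rw [mul_inv_eq_iff_eq_mul, ← h', mul_right_inj]

open Classical in
theorem simpleReflectionPerm_mul_pow_apply (i j : B) (k : ℕ) (t : W) (e : ZMod 2) :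
    ((cs.simpleReflectionPerm i * cs.simpleReflectionPerm j) ^ k) (t, e) =
      ((cs.simple i * cs.simple j) ^ k * t * ((cs.simple i * cs.simple j) ^ k)⁻¹,
        e + ∑ n ∈ Finset.range (2 * k),
          if t = cs.simple j * (cs.simple i * cs.simple j) ^ n then 1 else 0) := by
  induction k with
  | zero => simp
  | succ k ih =>
    have h0 := cs.conj_pow_eq_iff i j k 0 t
    have h1 := cs.conj_pow_eq_iff i j k 1 t
    rw [pow_zero, mul_one] at h0
    have h1' (x : W) : cs.simple j * x * cs.simple j = cs.simple i ↔
        x = cs.simple j * (cs.simple i * cs.simple j) ^ 1 := by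
      rw [pow_one]
      constructor
      · intro h
        simp [← h, mul_assoc]
      · rintro rfl
        simp [mul_assoc]
    rw [pow_succ', Equiv.Perm.mul_apply, ih, Equiv.Perm.mul_apply, simpleReflectionPerm_apply,
      simpleReflectionPerm_apply]
    simp only [h1', h0, h1, Nat.mul_succ, Finset.sum_range_succ, add_zero]
    ext
    · simp [pow_succ', mul_assoc]
    · simp only [add_assoc]

theorem isLiftable_simpleReflectionPerm : M.IsLiftable cs.simpleReflectionPerm := by
  classical
  intro i j
  ext1 ⟨t, e⟩
  rw [simpleReflectionPerm_mul_pow_apply, two_mul, Finset.sum_range_add]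
  simp [pow_add, CharTwo.add_self_eq_zero]

/-- The action of `W` on `W × ZMod 2` in which simple reflections act by
`simpleReflectionPerm`. -/
noncomputable def reflectionPerm : W →* Equiv.Perm (W × ZMod 2) :=
  cs.lift ⟨cs.simpleReflectionPerm, cs.isLiftable_simpleReflectionPerm⟩

theorem reflectionPerm_simple (i : B) :
    cs.reflectionPerm (cs.simple i) = cs.simpleReflectionPerm i :=
  cs.lift_apply_simple cs.isLiftable_simpleReflectionPerm i

/-- The number, modulo two, of occurrences of `t` in the left inversion sequence of any word
for `w`. -/
noncomputable def inversionParity (w t : W) : ZMod 2 := (cs.reflectionPerm w⁻¹ (t, 0)).2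

theorem reflectionPerm_apply (w t : W) (e : ZMod 2) :
    cs.reflectionPerm w (t, e) = (w * t * w⁻¹, e + cs.inversionParity w⁻¹ t) := by
  classical
  unfold inversionParity
  rw [inv_inv]
  induction w using cs.simple_induction_left generalizing e with
  | one => simp
  | mul_simple_left w i ih =>
    rw [map_mul, Equiv.Perm.mul_apply, Equiv.Perm.mul_apply, ih e, ih 0, reflectionPerm_simple,
      simpleReflectionPerm_apply, simpleReflectionPerm_apply]
    simp [mul_assoc, add_assoc]

theorem inversionParity_mul (w u t : W) :
    cs.inversionParity (w * u) t =
      cs.inversionParity w t + cs.inversionParity u (w⁻¹ * t * w) := by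
  rw [inversionParity, mul_inv_rev, map_mul, Equiv.Perm.mul_apply, reflectionPerm_apply,
    reflectionPerm_apply]
  simp

theorem inversionParity_one (t : W) : cs.inversionParity 1 t = 0 := by
  simp [inversionParity]

open Classical in
theorem inversionParity_simple (i : B) (t : W) :
    cs.inversionParity (cs.simple i) t = if t = cs.simple i then 1 else 0 := by
  simp [inversionParity, reflectionPerm_simple, simpleReflectionPerm_apply]

theorem IsReflection.inversionParity_self {t : W} (ht : cs.IsReflection t) :
    cs.inversionParity t t = 1 := by
  obtain ⟨u, i, rfl⟩ := ht
  have h := cs.inversionParity_mul u u⁻¹ (u * cs.simple i * u⁻¹)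
  rw [mul_inv_cancel, inversionParity_one] at h
  rw [inversionParity_mul, inversionParity_mul]
  simp only [mul_assoc, mul_inv_rev, inv_mul_cancel_left, inv_mul_cancel, mul_one, inv_simple,
    simple_mul_simple_self, inversionParity_simple, if_true] at h ⊢
  rw [add_right_comm, ← h, zero_add]

theorem length_mul_lt_of_inversionParity_eq_one {w t : W} (h : cs.inversionParity w t = 1) :
    cs.length (t * w) < cs.length w := by
  induction hn : cs.length w generalizing w with
  | zero =>
    rw [cs.length_eq_zero_iff] at hn
    simp [hn, inversionParity_one] at h
  | succ n ih =>
    have hw : w ≠ 1 := by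
      rintro rfl
      simp at hn
    obtain ⟨i, hi⟩ := cs.exists_rightDescent_of_ne_one hw
    rw [isRightDescent_iff] at hi
    obtain ⟨u, rfl⟩ : ∃ u, w = u * cs.simple i := ⟨w * cs.simple i, by simp⟩
    rw [simple_mul_simple_cancel_right] at hi
    rw [inversionParity_mul, inversionParity_simple] at h
    split_ifs at h with ht
    · obtain rfl : t = u * cs.simple i * u⁻¹ := by
        rw [← ht]
        group
      simp only [mul_assoc, inv_mul_cancel_left, simple_mul_simple_self, mul_one]
      omega
    · have := ih (by simpa using h) (by omega)
      have := cs.length_mul_le (t * u) (cs.simple i)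
      rw [length_simple, mul_assoc] at this
      omega

theorem IsReflection.length_mul_lt_iff {t : W} (ht : cs.IsReflection t) (w : W) :
    cs.length (t * w) < cs.length w ↔ cs.inversionParity w t = 1 := by
  refine ⟨fun hlt ↦ ?_, cs.length_mul_lt_of_inversionParity_eq_one⟩
  by_contra h
  have h0 : cs.inversionParity w t = 0 := (Fin.exists_fin_two.mp ⟨_, rfl⟩).resolve_right h
  have h1 : cs.inversionParity (t * w) t = 1 := by
    rw [inversionParity_mul, ht.inversionParity_self, inv_mul_cancel, one_mul, h0, add_zero]
  have := cs.length_mul_lt_of_inversionParity_eq_one h1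
  rw [← mul_assoc, ht.mul_self, one_mul] at this
  omega

end CoxeterSystem

theorem DesSet_eq_iff (cs : CoxeterSystem M W) {A : Set W}
    (hA : ∀ t ∈ A, cs.IsReflection t) (v w : W) :
    DesSet cs A v = DesSet cs A w ↔
      ∀ t ∈ A, cs.inversionParity v t = cs.inversionParity w t := by
  have key : ∀ a b : ZMod 2, (a = 1 ↔ b = 1) ↔ a = b := by decide
  simp only [DesSet, Set.ext_iff, Set.mem_ofPred_eq, and_congr_right_iff]
  refine forall₂_congr fun t ht ↦ ?_
  rw [(hA t ht).length_mul_lt_iff, (hA t ht).length_mul_lt_iff, key]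

theorem DesSet_mul_simple (cs : CoxeterSystem M W) {A : Set W}
    (hA : ∀ t ∈ A, cs.IsReflection t) {w : W} {i : B} (h : w * cs.simple i * w⁻¹ ∉ A) :
    DesSet cs A (w * cs.simple i) = DesSet cs A w := by
  rw [DesSet_eq_iff cs hA]
  intro t ht
  rw [cs.inversionParity_mul, cs.inversionParity_simple, if_neg, add_zero]
  intro hti
  apply h
  rw [← hti]
  simpa [mul_assoc] using ht

theorem ASim.desSet_eq (cs : CoxeterSystem M W) {A : Set W}
    (hA : ∀ t ∈ A, cs.IsReflection t) {w v : W} (h : ASim cs A w v) :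
    DesSet cs A v = DesSet cs A w := by
  induction h with
  | refl => rfl
  | tail _ hstep ih =>
    obtain ⟨i, rfl, hi⟩ := hstep
    rw [DesSet_mul_simple cs hA hi, ih]

theorem ASim_mul_of_desSet_eq (cs : CoxeterSystem M W) {A : Set W}
    (hA : ∀ t ∈ A, cs.IsReflection t) (w u : W)
    (h : DesSet cs A (w * u) = DesSet cs A w) : ASim cs A w (w * u) := by
  induction hn : cs.length u generalizing u with
  | zero =>
    rw [cs.length_eq_zero_iff] at hn
    rw [hn, mul_one]
    exact Relation.ReflTransGen.refl
  | succ n ih =>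
    have hu : u ≠ 1 := by
      rintro rfl
      simp at hn
    obtain ⟨i, hi⟩ := cs.exists_rightDescent_of_ne_one hu
    rw [cs.isRightDescent_iff] at hi
    obtain ⟨x, rfl⟩ : ∃ x, u = x * cs.simple i := ⟨u * cs.simple i, by simp⟩
    rw [simple_mul_simple_cancel_right] at hi
    have ht : cs.IsReflection (x * cs.simple i * x⁻¹) := ⟨x, i, rfl⟩
    have hpar : cs.inversionParity (x * cs.simple i) (x * cs.simple i * x⁻¹) = 1 := by
      rw [← ht.length_mul_lt_iff]
      simp only [mul_assoc, inv_mul_cancel_left, simple_mul_simple_self, mul_one]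
      omega
    have hnot : w * x * cs.simple i * (w * x)⁻¹ ∉ A := by
      intro hmem
      have heq := (DesSet_eq_iff cs hA _ _).mp h _ hmem
      rw [cs.inversionParity_mul, add_eq_left,
        show w⁻¹ * (w * x * cs.simple i * (w * x)⁻¹) * w = x * cs.simple i * x⁻¹ by group,
        hpar] at heq
      exact one_ne_zero heq
    have hdes := DesSet_mul_simple cs hA hnot
    rw [mul_assoc] at hdes
    exact (ih x (hdes.symm.trans h) (by omega)).tail ⟨i, (mul_assoc _ _ _).symm, hnot⟩

/-- the `∼_A`-equivalence class of `w` is the generalized descent class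
`W_A^{Des_A(w)}`; consequently the equivalence classes of `∼_A` are exactly the
nonempty generalized descent classes `W_A^D` with `D ⊆ A`. -/
theorem stmt6 (cs : CoxeterSystem M W) (A : Set W)
    (hA : ∀ t ∈ A, cs.IsReflection t) :
    (∀ w : W, {v | ASim cs A w v} = {v | DesSet cs A v = DesSet cs A w}) ∧
    (∀ D : Set W, D ⊆ A → {w : W | DesSet cs A w = D}.Nonempty →
      ∃ w₀ : W, {v | ASim cs A w₀ v} = {w : W | DesSet cs A w = D}) := by
  have hclass (w : W) : {v | ASim cs A w v} = {v | DesSet cs A v = DesSet cs A w} := by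
    ext v
    refine ⟨ASim.desSet_eq cs hA, fun h ↦ ?_⟩
    have := ASim_mul_of_desSet_eq cs hA w (w⁻¹ * v) (by simpa using h)
    simpa using this
  refine ⟨hclass, ?_⟩
  rintro _ - ⟨w₀, rfl⟩
  exact ⟨w₀, hclass w₀⟩
end

section
/- Let K ⊆ W and let ρ : S → End_F(V_K) be a map satisfying Axiom (B), with ḃ_t ≠ 0 and b̈_t ≠ 0 for all t ∈ T_K. Then the Hecke relations (ρ_s − 1)(ρ_s + q_s) = 0 hold for all s ∈ S if and only if both of the following hold: (a) for every t ∈ T_K, ȧ_t + ä_t = 1 − q_t and ḃ_t·b̈_t = (1 − ȧ_t)(1 − ä_t) ≠ 0; (b) for every w ∈ K and s ∈ S with ws ∉ K, the diagonal coefficient of ρ_s at C_w (namely ȧ_{wsw⁻¹} if ℓ(w) < ℓ(ws), and ä_{wsw⁻¹} if ℓ(w) > ℓ(ws)) belongs to {1, −q_s}. -/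
open CoxeterSystem

variable {B W : Type*} [Group W] {M : CoxeterMatrix B}

/-- `T_K`: reflections of the form `w s w⁻¹` with `w ∈ K` and `ws ∈ K`. -/
def TK (cs : CoxeterSystem M W) (K : Set W) : Set W :=
  {t | ∃ (i : B) (w : W), w ∈ K ∧ w * cs.simple i ∈ K ∧ t = w * cs.simple i * w⁻¹}

/-- `T_∂K`: reflections of the form `w s w⁻¹` with `w ∈ K` and `ws ∉ K`. -/
def TbK (cs : CoxeterSystem M W) (K : Set W) : Set W :=
  {t | ∃ (i : B) (w : W), w ∈ K ∧ w * cs.simple i ∉ K ∧ t = w * cs.simple i * w⁻¹}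

/-- A map `ρ : S → End_F(V_K)` satisfying Axiom (B), together with its coefficient data
`ȧ, ä, ḃ, b̈` (functions of the reflection `w s w⁻¹`). -/
structure AxiomBMap (cs : CoxeterSystem M W) (F : Type*) [Field F] (K : Set W) where
  ρ : B → Module.End F (↥K →₀ F)
  ad : W → F  -- ȧ
  aBar : W → F  -- ä
  bd : W → F  -- ḃ
  bBar : W → F  -- b̈
  axiomB_lt_mem : ∀ (i : B) (w : W) (hw : w ∈ K) (h : w * cs.simple i ∈ K),
    cs.length w < cs.length (w * cs.simple i) →
    ρ i (Cvec F K w hw) = ad (w * cs.simple i * w⁻¹) • Cvec F K w hw +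
      bd (w * cs.simple i * w⁻¹) • Cvec F K (w * cs.simple i) h
  axiomB_lt_not_mem : ∀ (i : B) (w : W) (hw : w ∈ K), w * cs.simple i ∉ K →
    cs.length w < cs.length (w * cs.simple i) →
    ρ i (Cvec F K w hw) = ad (w * cs.simple i * w⁻¹) • Cvec F K w hw
  axiomB_gt_mem : ∀ (i : B) (w : W) (hw : w ∈ K) (h : w * cs.simple i ∈ K),
    cs.length (w * cs.simple i) < cs.length w →
    ρ i (Cvec F K w hw) = aBar (w * cs.simple i * w⁻¹) • Cvec F K w hw +
      bBar (w * cs.simple i * w⁻¹) • Cvec F K (w * cs.simple i) h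
  axiomB_gt_not_mem : ∀ (i : B) (w : W) (hw : w ∈ K), w * cs.simple i ∉ K →
    cs.length (w * cs.simple i) < cs.length w →
    ρ i (Cvec F K w hw) = aBar (w * cs.simple i * w⁻¹) • Cvec F K w hw
  bd_eq_zero : ∀ (i : B) (w : W), w ∈ K → w * cs.simple i ∉ K →
    cs.length w < cs.length (w * cs.simple i) → bd (w * cs.simple i * w⁻¹) = 0
  bBar_eq_zero : ∀ (i : B) (w : W), w ∈ K → w * cs.simple i ∉ K →
    cs.length (w * cs.simple i) < cs.length w → bBar (w * cs.simple i * w⁻¹) = 0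

/-- The quadratic Hecke operator on a vector spanning an invariant line. -/
theorem hecke_apply_of_apply_eq_smul {R V : Type*} [CommRing R] [AddCommGroup V] [Module R V]
    {f : Module.End R V} {a : R} (q : R) {x : V} (hx : f x = a • x) :
    ((f - 1) * (f + q • 1)) x = ((a - 1) * (a + q)) • x := by
  simp only [Module.End.mul_apply, LinearMap.sub_apply, LinearMap.add_apply,
    LinearMap.smul_apply, Module.End.one_apply, map_add, map_smul, hx]
  module

/-- The quadratic Hecke operator on a vector of an invariant plane. -/
theorem hecke_apply_of_apply_eq_add {R V : Type*} [CommRing R] [AddCommGroup V] [Module R V]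
    {f : Module.End R V} {a b a' b' : R} (q : R) {x y : V}
    (hx : f x = a • x + b • y) (hy : f y = a' • y + b' • x) :
    ((f - 1) * (f + q • 1)) x =
      ((a - 1) * (a + q) + b * b') • x + (b * (a + a' - (1 - q))) • y := by
  simp only [Module.End.mul_apply, LinearMap.sub_apply, LinearMap.add_apply,
    LinearMap.smul_apply, Module.End.one_apply, map_add, map_smul, hx, hy]
  module

theorem smul_Cvec_eq_zero_iff {X F : Type*} [Field F] {K : Set X} {w : X} (hw : w ∈ K) {c : F} :
    c • Cvec F K w hw = 0 ↔ c = 0 := by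
  simp [Cvec]

theorem smul_Cvec_add_smul_Cvec_eq_zero_iff {X F : Type*} [Field F] {K : Set X} {w v : X}
    (hw : w ∈ K) (hv : v ∈ K) (hne : w ≠ v) {c d : F} :
    c • Cvec F K w hw + d • Cvec F K v hv = 0 ↔ c = 0 ∧ d = 0 := by
  refine ⟨fun h ↦ ⟨?_, ?_⟩, by rintro ⟨rfl, rfl⟩; simp⟩
  · simpa [Cvec, Finsupp.single_apply, hne, hne.symm] using DFunLike.congr_fun h ⟨w, hw⟩
  · simpa [Cvec, Finsupp.single_apply, hne, hne.symm] using DFunLike.congr_fun h ⟨v, hv⟩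

theorem eq_zero_of_forall_Cvec {X F : Type*} [Field F] {K : Set X} {f : Module.End F (↥K →₀ F)}
    (h : ∀ (w : X) (hw : w ∈ K), f (Cvec F K w hw) = 0) : f = 0 :=
  Finsupp.lhom_ext' fun ⟨w, hw⟩ ↦ LinearMap.ext_ring (by simpa [Cvec] using h w hw)

/-- Right multiplication by a simple reflection `s` does not change `w s w⁻¹`. -/
theorem mul_simple_conj_mul_simple (cs : CoxeterSystem M W) (w : W) (i : B) :
    w * cs.simple i * cs.simple i * (w * cs.simple i)⁻¹ = w * cs.simple i * w⁻¹ := by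
  simp [mul_assoc]

theorem AxiomBMap.hecke_Cvec_eq_zero_iff_of_lt {cs : CoxeterSystem M W} {F : Type*} [Field F]
    {K : Set W} (P : AxiomBMap cs F K) (q : F) {i : B} {w : W} (hw : w ∈ K)
    (h : w * cs.simple i ∈ K) (hl : cs.length w < cs.length (w * cs.simple i))
    (hb : P.bd (w * cs.simple i * w⁻¹) ≠ 0) (hb' : P.bBar (w * cs.simple i * w⁻¹) ≠ 0) :
    let t := w * cs.simple i * w⁻¹
    let H := (P.ρ i - 1) * (P.ρ i + q • 1)
    (H (Cvec F K w hw) = 0 ↔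
      P.ad t + P.aBar t = 1 - q ∧ P.bd t * P.bBar t = (1 - P.ad t) * (1 - P.aBar t)) ∧
    (H (Cvec F K (w * cs.simple i) h) = 0 ↔
      P.ad t + P.aBar t = 1 - q ∧ P.bd t * P.bBar t = (1 - P.ad t) * (1 - P.aBar t)) := by
  intro t H
  have hne : w ≠ w * cs.simple i := fun e ↦ hl.ne (congrArg cs.length e)
  have hx := P.axiomB_lt_mem i w hw h hl
  have hy := P.axiomB_gt_mem i (w * cs.simple i) h (by simpa using hw) (by simpa using hl)
  simp only [↓mul_simple_conj_mul_simple, cs.simple_mul_simple_cancel_right] at hy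
  constructor
  · rw [hecke_apply_of_apply_eq_add q hx hy, smul_Cvec_add_smul_Cvec_eq_zero_iff _ _ hne,
      mul_eq_zero, or_iff_right hb, sub_eq_zero]
    constructor <;> rintro ⟨h₁, h₂⟩ <;> constructor <;> grind
  · rw [hecke_apply_of_apply_eq_add q hy hx, smul_Cvec_add_smul_Cvec_eq_zero_iff _ _ hne.symm,
      mul_eq_zero, or_iff_right hb', sub_eq_zero]
    constructor <;> rintro ⟨h₁, h₂⟩ <;> constructor <;> grind

/-- For `w, ws ∈ K`, the Hecke relation at `C_w` amounts to the two coefficient identities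
at `w s w⁻¹`. -/
theorem AxiomBMap.hecke_Cvec_eq_zero_iff {cs : CoxeterSystem M W} {F : Type*} [Field F]
    {K : Set W} (P : AxiomBMap cs F K) (q : F) {i : B} {w : W} (hw : w ∈ K)
    (h : w * cs.simple i ∈ K)
    (hb : P.bd (w * cs.simple i * w⁻¹) ≠ 0) (hb' : P.bBar (w * cs.simple i * w⁻¹) ≠ 0) :
    let t := w * cs.simple i * w⁻¹
    ((P.ρ i - 1) * (P.ρ i + q • 1)) (Cvec F K w hw) = 0 ↔
      P.ad t + P.aBar t = 1 - q ∧ P.bd t * P.bBar t = (1 - P.ad t) * (1 - P.aBar t) := by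
  rcases (cs.length_mul_simple_ne w i).lt_or_gt with hl | hl
  · have := (P.hecke_Cvec_eq_zero_iff_of_lt q (i := i) h (by simpa using hw) (by simpa using hl)
      (by rwa [mul_simple_conj_mul_simple]) (by rwa [mul_simple_conj_mul_simple])).2
    simpa only [↓mul_simple_conj_mul_simple, cs.simple_mul_simple_cancel_right] using this
  · exact (P.hecke_Cvec_eq_zero_iff_of_lt q hw h hl hb hb').1

/-- For `w ∈ K` and `ws ∉ K`, the Hecke relation at `C_w` says that the diagonal coefficient
is `1` or `-q_s`. -/
theorem AxiomBMap.hecke_Cvec_eq_zero_iff_of_notMem {cs : CoxeterSystem M W} {F : Type*} [Field F]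
    {K : Set W} (P : AxiomBMap cs F K) (q : F) {i : B} {w : W} (hw : w ∈ K)
    (h : w * cs.simple i ∉ K) :
    let t := w * cs.simple i * w⁻¹
    ((P.ρ i - 1) * (P.ρ i + q • 1)) (Cvec F K w hw) = 0 ↔
      (cs.length w < cs.length (w * cs.simple i) → P.ad t = 1 ∨ P.ad t = -q) ∧
      (cs.length (w * cs.simple i) < cs.length w → P.aBar t = 1 ∨ P.aBar t = -q) := by
  intro t
  rcases (cs.length_mul_simple_ne w i).lt_or_gt with hl | hl
  · rw [hecke_apply_of_apply_eq_smul q (P.axiomB_gt_not_mem i w hw h hl),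
      smul_Cvec_eq_zero_iff, mul_eq_zero, sub_eq_zero, add_eq_zero_iff_eq_neg]
    simp [hl, hl.not_gt, t]
  · rw [hecke_apply_of_apply_eq_smul q (P.axiomB_lt_not_mem i w hw h hl),
      smul_Cvec_eq_zero_iff, mul_eq_zero, sub_eq_zero, add_eq_zero_iff_eq_neg]
    simp [hl, hl.not_gt, t]

/-- characterization of the Hecke relations `(ρ_s − 1)(ρ_s + q_s) = 0`
for a map satisfying Axiom (B). Here `q : B → F` are the parameters (constant on
conjugacy classes, as witnessed by the function `qT` on reflections with
`qT (w s w⁻¹) = q s`). -/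
theorem stmt9 (cs : CoxeterSystem M W) (F : Type*) [Field F] (K : Set W)
    (P : AxiomBMap cs F K)
    (q : B → F) (qT : W → F) (hqT : ∀ (w : W) (i : B), qT (w * cs.simple i * w⁻¹) = q i)
    (hbd : ∀ t ∈ TK cs K, P.bd t ≠ 0) (hbBar : ∀ t ∈ TK cs K, P.bBar t ≠ 0) :
    (∀ i : B, (P.ρ i - 1) * (P.ρ i + q i • 1) = 0) ↔
    ((∀ t ∈ TK cs K,
        P.ad t + P.aBar t = 1 - qT t ∧
        P.bd t * P.bBar t = (1 - P.ad t) * (1 - P.aBar t) ∧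
        P.bd t * P.bBar t ≠ 0) ∧
      (∀ (i : B) (w : W), w ∈ K → w * cs.simple i ∉ K →
        (cs.length w < cs.length (w * cs.simple i) →
          P.ad (w * cs.simple i * w⁻¹) = 1 ∨ P.ad (w * cs.simple i * w⁻¹) = -(q i)) ∧
        (cs.length (w * cs.simple i) < cs.length w →
          P.aBar (w * cs.simple i * w⁻¹) = 1 ∨ P.aBar (w * cs.simple i * w⁻¹) = -(q i)))) := by
  constructor
  · intro H
    refine ⟨?_, fun i w hw h ↦
      (P.hecke_Cvec_eq_zero_iff_of_notMem (q i) hw h).1 (by rw [H i, LinearMap.zero_apply])⟩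
    rintro _ ⟨i, w, hw, h, rfl⟩
    have hb := hbd _ ⟨i, w, hw, h, rfl⟩
    have hb' := hbBar _ ⟨i, w, hw, h, rfl⟩
    obtain ⟨h₁, h₂⟩ := (P.hecke_Cvec_eq_zero_iff (q i) hw h hb hb').1
      (by rw [H i, LinearMap.zero_apply])
    exact ⟨by rw [hqT, h₁], h₂, mul_ne_zero hb hb'⟩
  · rintro ⟨ha, hbdry⟩ i
    refine eq_zero_of_forall_Cvec fun w hw ↦ ?_
    by_cases h : w * cs.simple i ∈ K
    · have ht : w * cs.simple i * w⁻¹ ∈ TK cs K := ⟨i, w, hw, h, rfl⟩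
      obtain ⟨h₁, h₂, -⟩ := ha _ ht
      exact (P.hecke_Cvec_eq_zero_iff (q i) hw h (hbd _ ht) (hbBar _ ht)).2
        ⟨by rw [h₁, hqT], h₂⟩
    · exact (P.hecke_Cvec_eq_zero_iff_of_notMem (q i) hw h).2 (hbdry i w hw h)
end

section
/- Let K ⊆ W and let ρ : S → End_F(V_K) be a map satisfying Axiom (B). If s,t ∈ S satisfy m(s,t) = 2 (i.e., st = ts), then ρ_s ρ_t = ρ_t ρ_s. -/
open CoxeterSystem

variable {B W : Type*} [Group W] {M : CoxeterMatrix B}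

open Classical in
/-- The map `(t, ε) ↦ (s t s, ε + [t = s])` on `W × ZMod 2`, for `s` the simple reflection `i`. -/
noncomputable def reflectionStep (cs : CoxeterSystem M W) (i : B) : Function.End (W × ZMod 2) :=
  fun p ↦ (cs.simple i * p.1 * cs.simple i, p.2 + if p.1 = cs.simple i then 1 else 0)

open Classical in
theorem reflectionStep_mul_pow (cs : CoxeterSystem M W) (i j : B) (n : ℕ) (p : W × ZMod 2) :
    ((reflectionStep cs i * reflectionStep cs j) ^ n) p =
      ((cs.simple i * cs.simple j) ^ n * p.1 * ((cs.simple i * cs.simple j) ^ n)⁻¹,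
        p.2 + ∑ l ∈ Finset.range (2 * n),
          if (cs.simple i * cs.simple j) ^ l * p.1 = cs.simple j then 1 else 0) := by
  induction n with
  | zero => simp; rfl
  | succ n ih =>
    obtain ⟨t, ε⟩ := p
    rw [pow_succ']
    change reflectionStep cs i (reflectionStep cs j
      (((reflectionStep cs i * reflectionStep cs j) ^ n) (t, ε))) = _
    rw [ih]
    have hai := cs.inv_simple i
    have hbi := cs.inv_simple j
    simp only [reflectionStep]
    generalize cs.simple i = a at *
    generalize cs.simple j = b at *
    have hbc (k : ℕ) : b * (a * b) ^ k = ((a * b) ^ k)⁻¹ * b := by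
      have h : SemiconjBy b (a * b) (a * b)⁻¹ := by
        simp [SemiconjBy, mul_assoc, hai, hbi]
      exact inv_pow (a * b) k ▸ (h.pow_right k).eq
    have h₁ : (a * b) ^ n * t * ((a * b) ^ n)⁻¹ = b ↔ (a * b) ^ (2 * n) * t = b := by
      rw [mul_inv_eq_iff_eq_mul, hbc, eq_inv_mul_iff_mul_eq, two_mul, pow_add, mul_assoc]
    have h₂ : b * ((a * b) ^ n * t * ((a * b) ^ n)⁻¹) * b = a ↔
        (a * b) ^ (2 * n + 1) * t = b := by
      have e : b * ((a * b) ^ n * t * ((a * b) ^ n)⁻¹) * b = a ↔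
          (a * b) ^ n * t * ((a * b) ^ n)⁻¹ = (a * b)⁻¹ * b := by
        rw [← eq_mul_inv_iff_mul_eq, ← eq_inv_mul_iff_mul_eq, mul_inv_rev, hai, hbi,
          mul_assoc b a b]
      rw [e, mul_inv_eq_iff_eq_mul, mul_assoc, hbc, eq_inv_mul_iff_mul_eq,
        eq_inv_mul_iff_mul_eq, ← mul_assoc, ← mul_assoc, ← pow_succ, ← pow_add,
        show n + 1 + n = 2 * n + 1 by ring]
    rw [show 2 * (n + 1) = 2 * n + 1 + 1 by ring, Finset.sum_range_succ, Finset.sum_range_succ]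
    simp only [h₁, h₂, add_assoc]
    simp only [pow_succ', mul_inv_rev, hai, hbi, mul_assoc]

theorem isLiftable_reflectionStep (cs : CoxeterSystem M W) :
    M.IsLiftable (reflectionStep cs) := by
  classical
  intro i j
  funext p
  rw [reflectionStep_mul_pow, two_mul, Finset.sum_range_add]
  simp only [pow_add, cs.simple_mul_simple_pow, one_mul, CharTwo.add_self_eq_zero]
  simp
  rfl

/-- The action of `W` on `W × ZMod 2` in which the second coordinate records, modulo two, how often
a reflection occurs in the right inversion sequence of a word. -/
noncomputable def reflectionAction (cs : CoxeterSystem M W) : W →* Function.End (W × ZMod 2) :=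
  cs.lift ⟨reflectionStep cs, isLiftable_reflectionStep cs⟩

theorem reflectionAction_simple (cs : CoxeterSystem M W) (i : B) :
    reflectionAction cs (cs.simple i) = reflectionStep cs i :=
  cs.lift_apply_simple (isLiftable_reflectionStep cs) i

theorem reflectionAction_mul_apply (cs : CoxeterSystem M W) (v w : W) (p : W × ZMod 2) :
    reflectionAction cs (v * w) p = reflectionAction cs v (reflectionAction cs w p) := by
  rw [map_mul]; rfl

theorem reflectionAction_apply_fst (cs : CoxeterSystem M W) (w : W) (p : W × ZMod 2) :
    (reflectionAction cs w p).1 = w * p.1 * w⁻¹ := by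
  induction w using cs.simple_induction_left with
  | one => simp; rfl
  | mul_simple_left w i ih =>
    rw [reflectionAction_mul_apply, reflectionAction_simple]
    simp [reflectionStep, ih, mul_assoc]

theorem reflectionAction_apply_snd (cs : CoxeterSystem M W) (w t : W) (ε : ZMod 2) :
    (reflectionAction cs w (t, ε)).2 = ε + (reflectionAction cs w (t, 0)).2 := by
  classical
  induction w using cs.simple_induction_left with
  | one => rw [map_one]; exact (add_zero ε).symm
  | mul_simple_left w i ih =>
    simp only [reflectionAction_mul_apply, reflectionAction_simple]
    simp [reflectionStep, ih, reflectionAction_apply_fst, add_assoc]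

theorem mem_rightInvSeq_of_reflectionAction_snd_ne_zero (cs : CoxeterSystem M W) (ω : List B)
    (t : W) (h : (reflectionAction cs (cs.wordProd ω) (t, 0)).2 ≠ 0) : t ∈ cs.rightInvSeq ω := by
  classical
  induction ω with
  | nil => rw [cs.wordProd_nil, map_one] at h; exact absurd rfl h
  | cons i ω ih =>
    rw [cs.wordProd_cons, reflectionAction_mul_apply, reflectionAction_simple] at h
    simp only [reflectionStep, reflectionAction_apply_fst] at h
    simp only [rightInvSeq, List.mem_cons]
    by_cases ht : cs.wordProd ω * t * (cs.wordProd ω)⁻¹ = cs.simple i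
    · left
      simp [← ht, mul_assoc]
    · right
      exact ih (by simpa only [ht, if_false, add_zero] using h)

theorem isRightDescent_of_reflectionAction_snd_ne_zero (cs : CoxeterSystem M W) (w : W) (i : B)
    (h : (reflectionAction cs w (cs.simple i, 0)).2 ≠ 0) : cs.IsRightDescent w i := by
  obtain ⟨ω, hω, rfl⟩ := cs.exists_isReduced w
  exact (cs.isRightInversion_of_mem_rightInvSeq hω
    (mem_rightInvSeq_of_reflectionAction_snd_ne_zero cs ω _ h)).2

theorem isRightDescent_iff_reflectionAction_snd_ne_zero (cs : CoxeterSystem M W) (w : W) (i : B) :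
    cs.IsRightDescent w i ↔ (reflectionAction cs w (cs.simple i, 0)).2 ≠ 0 := by
  refine ⟨fun h h0 ↦ ?_, isRightDescent_of_reflectionAction_snd_ne_zero cs w i⟩
  refine cs.isRightDescent_iff_not_isRightDescent_mul.1 h
    (isRightDescent_of_reflectionAction_snd_ne_zero cs _ i ?_)
  rw [reflectionAction_mul_apply, reflectionAction_simple]
  simp [reflectionStep, reflectionAction_apply_snd cs w _ 1, h0]

/-- Right multiplication by a simple reflection commuting with, and different from, `s i` does not
change whether `s i` is a right descent. -/
theorem isRightDescent_mul_simple_iff (cs : CoxeterSystem M W) (w : W) {i j : B}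
    (hc : Commute (cs.simple i) (cs.simple j)) (hne : cs.simple i ≠ cs.simple j) :
    cs.IsRightDescent (w * cs.simple j) i ↔ cs.IsRightDescent w i := by
  rw [isRightDescent_iff_reflectionAction_snd_ne_zero,
    isRightDescent_iff_reflectionAction_snd_ne_zero, reflectionAction_mul_apply,
    reflectionAction_simple]
  simp [reflectionStep, hne, ← hc.eq]

namespace AxiomBMap

variable {cs : CoxeterSystem M W} {F : Type*} [Field F] {K : Set W}

open Classical in
/-- The diagonal coefficient of `ρ i` at `C_w`. -/
noncomputable def diagCoeff (P : AxiomBMap cs F K) (i : B) (w : W) : F :=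
  if cs.IsRightDescent w i then P.aBar (w * cs.simple i * w⁻¹) else P.ad (w * cs.simple i * w⁻¹)

open Classical in
/-- The coefficient of `C_{ws}` in `ρ i (C_w)`. -/
noncomputable def offDiagCoeff (P : AxiomBMap cs F K) (i : B) (w : W) : F :=
  if cs.IsRightDescent w i then P.bBar (w * cs.simple i * w⁻¹) else P.bd (w * cs.simple i * w⁻¹)

open Classical in
/-- The vector `C_w`, extended by zero to `w ∉ K`. -/
noncomputable def extendedCvec (F : Type*) [Field F] (K : Set W) (w : W) : ↥K →₀ F :=
  if hw : w ∈ K then Cvec F K w hw else 0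

theorem end_ext_extendedCvec {α F : Type*} [Field F] {K : Set α} {f g : Module.End F (↥K →₀ F)}
    (h : ∀ w ∈ K, f (extendedCvec F K w) = g (extendedCvec F K w)) : f = g := by
  refine Finsupp.lhom_ext' fun ⟨w, hw⟩ ↦ LinearMap.ext_ring ?_
  simpa [extendedCvec, hw, Cvec] using h w hw

theorem length_lt_of_not_isRightDescent {w : W} {i : B} (h : ¬cs.IsRightDescent w i) :
    cs.length w < cs.length (w * cs.simple i) :=
  lt_of_le_of_ne (not_lt.1 h) (cs.length_mul_simple_ne w i).symm

theorem offDiagCoeff_eq_zero (P : AxiomBMap cs F K) (i : B) {w : W} (hw : w ∈ K)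
    (h : w * cs.simple i ∉ K) : P.offDiagCoeff i w = 0 := by
  unfold offDiagCoeff
  split_ifs with hd
  · exact P.bBar_eq_zero i w hw h hd
  · exact P.bd_eq_zero i w hw h (length_lt_of_not_isRightDescent hd)

theorem apply_extendedCvec (P : AxiomBMap cs F K) (i : B) {w : W} (hw : w ∈ K) :
    P.ρ i (extendedCvec F K w) = P.diagCoeff i w • extendedCvec F K w +
      P.offDiagCoeff i w • extendedCvec F K (w * cs.simple i) := by
  by_cases h : w * cs.simple i ∈ K <;> by_cases hd : cs.IsRightDescent w i <;>
    simp only [extendedCvec, diagCoeff, offDiagCoeff, hw, h, hd, dite_true, dite_false, if_true,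
      if_false, smul_zero, add_zero]
  · exact P.axiomB_gt_mem i w hw h hd
  · exact P.axiomB_lt_mem i w hw h (length_lt_of_not_isRightDescent hd)
  · exact P.axiomB_gt_not_mem i w hw h hd
  · exact P.axiomB_lt_not_mem i w hw h (length_lt_of_not_isRightDescent hd)

theorem offDiagCoeff_smul_apply (P : AxiomBMap cs F K) (i j : B) {w : W} (hw : w ∈ K) :
    P.offDiagCoeff j w • P.ρ i (extendedCvec F K (w * cs.simple j)) =
      P.offDiagCoeff j w • (P.diagCoeff i (w * cs.simple j) • extendedCvec F K (w * cs.simple j) +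
        P.offDiagCoeff i (w * cs.simple j) •
          extendedCvec F K (w * cs.simple j * cs.simple i)) := by
  by_cases h : w * cs.simple j ∈ K
  · rw [P.apply_extendedCvec i h]
  · rw [P.offDiagCoeff_eq_zero j hw h, zero_smul, zero_smul]

theorem mul_simple_conj {i j : B} (hc : Commute (cs.simple i) (cs.simple j)) (w : W) :
    w * cs.simple j * cs.simple i * (w * cs.simple j)⁻¹ = w * cs.simple i * w⁻¹ := by
  rw [mul_assoc w, ← hc.eq]
  simp [mul_assoc]

theorem diagCoeff_mul_simple (P : AxiomBMap cs F K) {i j : B}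
    (hc : Commute (cs.simple i) (cs.simple j)) (hne : cs.simple i ≠ cs.simple j) (w : W) :
    P.diagCoeff i (w * cs.simple j) = P.diagCoeff i w := by
  classical
  simp only [diagCoeff, mul_simple_conj hc, isRightDescent_mul_simple_iff cs w hc hne]

theorem offDiagCoeff_mul_simple (P : AxiomBMap cs F K) {i j : B}
    (hc : Commute (cs.simple i) (cs.simple j)) (hne : cs.simple i ≠ cs.simple j) (w : W) :
    P.offDiagCoeff i (w * cs.simple j) = P.offDiagCoeff i w := by
  classical
  simp only [offDiagCoeff, mul_simple_conj hc, isRightDescent_mul_simple_iff cs w hc hne]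

theorem apply_extendedCvec_congr (P : AxiomBMap cs F K) {i j : B}
    (h : cs.simple i = cs.simple j) {w : W} (hw : w ∈ K) :
    P.ρ i (extendedCvec F K w) = P.ρ j (extendedCvec F K w) := by
  have hd : cs.IsRightDescent w i ↔ cs.IsRightDescent w j := by
    simp only [CoxeterSystem.IsRightDescent, h]
  classical
  simp only [P.apply_extendedCvec _ hw, diagCoeff, offDiagCoeff, hd, h]

theorem apply_apply_extendedCvec (P : AxiomBMap cs F K) {i j : B}
    (hc : Commute (cs.simple i) (cs.simple j)) (hne : cs.simple i ≠ cs.simple j) {w : W}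
    (hw : w ∈ K) :
    P.ρ i (P.ρ j (extendedCvec F K w)) =
      P.diagCoeff j w • (P.diagCoeff i w • extendedCvec F K w +
        P.offDiagCoeff i w • extendedCvec F K (w * cs.simple i)) +
      P.offDiagCoeff j w • (P.diagCoeff i w • extendedCvec F K (w * cs.simple j) +
        P.offDiagCoeff i w • extendedCvec F K (w * cs.simple j * cs.simple i)) := by
  rw [P.apply_extendedCvec j hw, map_add, map_smul, map_smul, P.apply_extendedCvec i hw,
    P.offDiagCoeff_smul_apply i j hw, P.diagCoeff_mul_simple hc hne,
    P.offDiagCoeff_mul_simple hc hne]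

end AxiomBMap

/-- for a map satisfying Axiom (B), if `m(s,t) = 2` then `ρ_s ρ_t = ρ_t ρ_s`. -/
theorem stmt10 (cs : CoxeterSystem M W) (F : Type*) [Field F] (K : Set W)
    (P : AxiomBMap cs F K) (i j : B) (hm : M i j = 2) :
    P.ρ i * P.ρ j = P.ρ j * P.ρ i := by
  have hc : Commute (cs.simple i) (cs.simple j) := by
    have h := cs.simple_mul_simple_pow i j
    rw [hm, pow_two, mul_eq_one_iff_eq_inv, mul_inv_rev, cs.inv_simple, cs.inv_simple] at h
    exact h
  refine AxiomBMap.end_ext_extendedCvec fun w hw ↦ ?_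
  change P.ρ i (P.ρ j _) = P.ρ j (P.ρ i _)
  by_cases hne : cs.simple i = cs.simple j
  · have h : P.ρ i = P.ρ j := AxiomBMap.end_ext_extendedCvec
      fun v hv ↦ P.apply_extendedCvec_congr hne hv
    rw [h]
  · rw [P.apply_apply_extendedCvec hc hne hw, P.apply_apply_extendedCvec hc.symm (Ne.symm hne) hw,
      mul_assoc w, mul_assoc w, hc.eq]
    module
end
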